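/- Let X = [u₁,v₁] × … × [u_{p−1},v_{p−1}] ⊂ ℝ^{p−1} with u_i < v_i, let β = (β₀,β₁,…,β_{p−1}) ∈ ℝ^p with β_i ≠ 0 for i = 1,…,p−1, and let d = (d₁,…,d_{p−1}) with d_i = v_i if β_i > 0 and d_i = u_i if β_i < 0. For z > 0 set w_p*(z) := 2 / ( p + √( (p−2)² + 4·(p−1)·e^{z} ) ) and w₁*(z) := (1 − w_p*(z))/(p−1), and let z* be the unique solution in (0,∞) of z·(1 − w_p*(z)) = 2. Assume z* ≤ min_{i=1,…,p−1} |β_i|·(v_i − u_i). Let ξ* be the design with support points d − (z*/β_i)·e_i for i = 1,…,p−1 (each with weight w₁*(z*)) and d (with weight w_p*(z*)). Then M_Po(ξ*;β) is invertible and ξ* is D_s-optimal for β₁,…,β_{p−1} in the Poisson model on X: for every design ξ on X (a finite family of points y₁,…,y_l ∈ X with weights q₁,…,q_l ≥ 0 summing to 1) and every p×p matrix G with M_Po(ξ;β)·G·M_Po(ξ;β) = M_Po(ξ;β) such that there exists a p×(p−1) matrix H with A = M_Po(ξ;β)·H (identifiability of Aᵀβ), one has det(Aᵀ·M_Po(ξ*;β)⁻¹·A)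 ≤ det(Aᵀ·G·A), where Aᵀ = (0_{p−1}, I_{p−1}). -/

import Mathlib

open Matrix Real Finset

/-- The regression vector `f(x) = (1, xᵀ)ᵀ ∈ ℝ^p` of multiple regression. -/
noncomputable def fvec (p : ℕ) (x : Fin (p - 1) → ℝ) : Fin p → ℝ :=
  fun j => if h : (j : ℕ) = 0 then 1 else x ⟨(j : ℕ) - 1, by have := j.isLt; omega⟩

/-- The information matrix of the Poisson model for the design with support points
`x j` and weights `w j`. -/
noncomputable def infoMPo {p l : ℕ} (β : Fin p → ℝ)
    (x : Fin l → Fin (p - 1) → ℝ) (w : Fin l → ℝ) : Matrix (Fin p) (Fin p) ℝ :=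
  ∑ j, (w j * Real.exp (fvec p (x j) ⬝ᵥ β)) •
    Matrix.vecMulVec (fvec p (x j)) (fvec p (x j))

theorem two_sub_mul_exp_le {x : ℝ} (hx : 0 ≤ x) : (2 - x) * exp x ≤ 2 + x := by
  have hd : ∀ t : ℝ, HasDerivAt (fun t => 2 + t - (2 - t) * exp t) (1 - (1 - t) * exp t) t := by
    intro t
    have h := ((hasDerivAt_id t).const_add 2).sub
      (((hasDerivAt_id t).const_sub 2).mul (Real.hasDerivAt_exp t))
    refine h.congr_deriv ?_
    simp only [id]
    ring
  have hm : Monotone (fun t : ℝ => 2 + t - (2 - t) * exp t) := by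
    refine monotone_of_hasDerivAt_nonneg hd fun t => ?_
    have h1 := Real.add_one_le_exp (-t)
    have h2 : exp (-t) * exp t = 1 := by rw [← Real.exp_add]; simp
    have h3 := mul_le_mul_of_nonneg_right h1 (exp_pos t).le
    simp only [Pi.zero_apply]
    linarith
  have h := hm hx
  simp only [sub_zero, add_zero, exp_zero, mul_one, sub_self] at h
  linarith

theorem antitoneOn_exp_neg_div_sq :
    AntitoneOn (fun x : ℝ => (exp (-x) - 1 + x) / x ^ 2) (Set.Ioi 0) := by
  have hd : ∀ t : ℝ, 0 < t → HasDerivAt (fun x : ℝ => (exp (-x) - 1 + x) / x ^ 2)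
      (((-exp (-t) + 1) * t ^ 2 - (exp (-t) - 1 + t) * (2 * t)) / (t ^ 2) ^ 2) t := by
    intro t ht
    have h := (((((hasDerivAt_id t).neg).exp).sub_const 1).add (hasDerivAt_id t)).div
      ((hasDerivAt_id t).pow 2) (pow_ne_zero 2 ht.ne')
    refine h.congr_deriv ?_
    simp
  refine antitoneOn_of_deriv_nonpos (convex_Ioi 0)
    (fun t ht => (hd t ht).continuousAt.continuousWithinAt)
    (fun t ht => ?_) (fun t ht => ?_)
  · rw [interior_Ioi] at ht
    exact (hd t ht).differentiableAt.differentiableWithinAt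
  · rw [interior_Ioi] at ht
    have ht : 0 < t := ht
    rw [(hd t ht).deriv]
    refine div_nonpos_of_nonpos_of_nonneg ?_ (by positivity)
    have h1 := two_sub_mul_exp_le ht.le
    have h2 : exp t * exp (-t) = 1 := by rw [← Real.exp_add]; simp
    have h3 := mul_le_mul_of_nonneg_right h1 (exp_pos (-t)).le
    rw [mul_assoc, h2] at h3
    nlinarith

/-- Monotonicity of `y ↦ (exp y - 1 - y) / y ^ 2`, compared at `-z` and `y`. -/
theorem sq_mul_exp_neg_le_sq_mul_exp {z y : ℝ} (hz : 0 < z) (hy : -z ≤ y) :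
    y ^ 2 * (exp (-z) - 1 + z) ≤ z ^ 2 * (exp y - 1 - y) := by
  rcases le_or_gt 0 y with h0 | h0
  · have h1 := Real.quadratic_le_exp_of_nonneg h0
    have h2 := Real.quadratic_le_exp_of_nonneg hz.le
    have h3 : exp z * exp (-z) = 1 := by rw [← Real.exp_add]; simp
    have h4 : exp (-z) ≤ 1 - z + z ^ 2 / 2 := by
      have := mul_le_mul_of_nonneg_right h2 (exp_pos (-z)).le
      rw [h3] at this
      have hp : 0 < 1 + z + z ^ 2 / 2 := by positivity
      refine le_of_mul_le_mul_left ?_ hp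
      nlinarith [pow_pos hz 4]
    nlinarith [mul_le_mul_of_nonneg_left h4 (sq_nonneg y),
      mul_le_mul_of_nonneg_left h1 (sq_nonneg z)]
  · have h := antitoneOn_exp_neg_div_sq (show -y ∈ Set.Ioi (0 : ℝ) by simpa using h0)
      (show z ∈ Set.Ioi (0 : ℝ) from hz) (by linarith : -y ≤ z)
    simp only [neg_neg, neg_sq] at h
    have hy0 : y ≠ 0 := h0.ne
    rw [div_le_div_iff₀ (by positivity) (by positivity)] at h
    nlinarith

/-- The quadratic interpolating `n * exp (z * r)` at `0` and, doubly, at `1` lies below it. -/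
theorem quadratic_le_mul_exp {n w z r : ℝ} (hn : 0 < n) (hw : 0 < w) (hw1 : w < 1) (hz : 0 < z)
    (hr : 0 ≤ r) (hzw : z * (1 - w) = 2) (hquad : (1 - w) * (1 - n * w) = n * exp z * w ^ 2) :
    n * exp z / (1 - w) * r ^ 2 + (1 - r) ^ 2 / w - exp z / (1 - w + w * exp z)
      ≤ n * exp (z * r) := by
  have h1w : 0 < 1 - w := by linarith
  have h := sq_mul_exp_neg_le_sq_mul_exp hz (y := z * (r - 1)) (by nlinarith)
  have hE : exp (z * (r - 1)) = exp (z * r) / exp z := by rw [← Real.exp_sub]; ring_nf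
  rw [hE, Real.exp_neg] at h
  have hEp := exp_pos z
  generalize exp (z * r) = F at *
  generalize exp z = E at *
  have hD : 1 - w + w * E = (1 - w) / (n * w) := by
    field_simp
    linarith
  have hz' : z = 2 / (1 - w) := by field_simp; linarith
  have h5 : (r - 1) ^ 2 * (1 - E + z * E) + E + E * z * (r - 1) ≤ F := by
    have h6 : z ^ 2 * E * ((r - 1) ^ 2 * (E⁻¹ - 1 + z)) ≤
        z ^ 2 * E * (F / E - 1 - z * (r - 1)) := by nlinarith
    have h7 := le_of_mul_le_mul_left h6 (by positivity)
    have h8 := mul_le_mul_of_nonneg_left h7 hEp.le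
    have h9 : E * ((r - 1) ^ 2 * (E⁻¹ - 1 + z)) = (r - 1) ^ 2 * (1 - E + z * E) := by
      field_simp
    have h10 : E * (F / E - 1 - z * (r - 1)) = F - E - E * z * (r - 1) := by
      field_simp
    rw [h9, h10] at h8
    linarith
  refine le_trans (le_of_eq ?_) (mul_le_mul_of_nonneg_left h5 hn.le)
  rw [hD, hz']
  have h1 : 1 - w ≠ 0 := h1w.ne'
  field_simp
  linear_combination (1 - r) ^ 2 * hquad

theorem Matrix.PosSemidef.det_le_one_of_trace_le {ι : Type*} [Fintype ι] [DecidableEq ι]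
    {P : Matrix ι ι ℝ} (hP : P.PosSemidef) (htr : P.trace ≤ Fintype.card ι) : P.det ≤ 1 := by
  have h1 := hP.1.det_eq_prod_eigenvalues
  have h2 := hP.1.trace_eq_sum_eigenvalues
  simp only [RCLike.ofReal_real_eq_id, id] at h1 h2
  rw [h1]
  calc ∏ i, hP.1.eigenvalues i ≤ ∏ i, exp (hP.1.eigenvalues i - 1) :=
        Finset.prod_le_prod (fun i _ => hP.eigenvalues_nonneg i) fun i _ => by
          have := Real.add_one_le_exp (hP.1.eigenvalues i - 1)
          linarith
    _ = exp (P.trace - Fintype.card ι) := by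
        rw [← Real.exp_sum, Finset.sum_sub_distrib, ← h2]
        simp
    _ ≤ 1 := by
        rw [Real.exp_le_one_iff]
        linarith

open scoped MatrixOrder in
theorem Matrix.PosSemidef.det_mul_le_one_of_trace_mul_le {ι : Type*} [Fintype ι] [DecidableEq ι]
    {P M : Matrix ι ι ℝ} (hP : P.PosSemidef) (hM : M.PosSemidef)
    (htr : (P * M).trace ≤ Fintype.card ι) : (P * M).det ≤ 1 := by
  obtain ⟨B, rfl⟩ := CStarAlgebra.nonneg_iff_eq_star_mul_self.mp hM.nonneg
  rw [star_eq_conjTranspose] at *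
  rw [← Matrix.mul_assoc, ← Matrix.trace_mul_cycle] at htr
  have h := (hP.mul_mul_conjTranspose_same B).det_le_one_of_trace_le
    (by rwa [Matrix.trace_mul_cycle])
  refine le_trans (le_of_eq ?_) h
  simp only [Matrix.det_mul]
  ring

theorem Matrix.trace_mul_sum_smul_vecMulVec {ι κ : Type*} [Fintype ι] [Fintype κ]
    (K : Matrix ι ι ℝ) (c : κ → ℝ) (g : κ → ι → ℝ) :
    (K * ∑ j, c j • vecMulVec (g j) (g j)).trace = ∑ j, c j * (g j ⬝ᵥ K *ᵥ g j) := by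
  simp only [Matrix.mul_sum, Matrix.trace_sum, Matrix.mul_smul, Matrix.trace_smul,
    Matrix.mul_vecMulVec, Matrix.trace_vecMulVec, smul_eq_mul]
  exact Finset.sum_congr rfl fun j _ => by rw [dotProduct_comm]

theorem Matrix.posSemidef_sum_smul_vecMulVec {ι κ : Type*} [Fintype ι] [Fintype κ]
    {c : κ → ℝ} (hc : ∀ j, 0 ≤ c j) (g : κ → ι → ℝ) :
    (∑ j, c j • vecMulVec (g j) (g j)).PosSemidef :=
  Matrix.posSemidef_sum _ fun j _ =>
    Matrix.PosSemidef.smul (by simpa using posSemidef_vecMulVec_self_star (g j)) (hc j)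

theorem Matrix.PosDef.posSemidef_inv_sub {ι : Type*} [Fintype ι] [DecidableEq ι]
    {N : Matrix ι ι ℝ} (hN : N.PosDef) (i : ι) :
    (N⁻¹ - (N i i)⁻¹ • vecMulVec (Pi.single i 1) (Pi.single i 1)).PosSemidef := by
  set E : Matrix ι ι ℝ := vecMulVec (Pi.single i 1) (Pi.single i 1) with hE
  have ha : N i i ≠ 0 := hN.diag_pos.ne'
  have hu : IsUnit N.det := (Matrix.isUnit_iff_isUnit_det N).mp hN.isUnit
  have hENE : E * N * E = N i i • E := by
    rw [hE, Matrix.mul_assoc, Matrix.mul_vecMulVec, Matrix.vecMulVec_mul_vecMulVec]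
    simp
  have hEt : Eᴴ = E := by
    rw [hE, Matrix.conjTranspose_vecMulVec]
    simp
  have h := hN.posSemidef.mul_mul_conjTranspose_same (N⁻¹ - (N i i)⁻¹ • E)
  convert h using 1
  rw [Matrix.conjTranspose_sub, Matrix.conjTranspose_smul, hEt, hN.inv.isHermitian.eq,
    Matrix.sub_mul, Matrix.nonsing_inv_mul _ hu, Matrix.sub_mul, Matrix.mul_sub, Matrix.mul_sub]
  simp only [Matrix.smul_mul, Matrix.mul_smul, hENE, Matrix.mul_assoc,
    Matrix.mul_nonsing_inv _ hu, Matrix.one_mul, Matrix.mul_one]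
  simp [smul_smul, ha]

/-- Sufficiency part of the equivalence theorem for `D_s`-optimality with one nuisance
parameter `i`. -/
theorem Matrix.PosDef.det_mul_diag_le {ι : Type*} [Fintype ι] [DecidableEq ι]
    {N M : Matrix ι ι ℝ} (hN : N.PosDef) (hM : M.PosDef) (i : ι)
    (h : (N⁻¹ * M).trace - M i i / N i i ≤ Fintype.card ι - 1) :
    M.det * N i i ≤ N.det * M i i := by
  set E : Matrix ι ι ℝ := vecMulVec (Pi.single i 1) (Pi.single i 1) with hE
  have hn : 0 < N i i := hN.diag_pos
  have hm : 0 < M i i := hM.diag_pos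
  have hu : IsUnit N.det := (Matrix.isUnit_iff_isUnit_det N).mp hN.isUnit
  set c : ℝ := (M i i)⁻¹ - (N i i)⁻¹ with hc
  have hEps : E.PosSemidef := by simpa using posSemidef_vecMulVec_self_star (Pi.single i (1 : ℝ))
  have hP : (N⁻¹ + c • E).PosSemidef := by
    have h1 := (hN.posSemidef_inv_sub i).add (hEps.smul (inv_pos.mpr hm).le)
    convert h1 using 1
    rw [hc, sub_smul]
    abel
  have htr : ((N⁻¹ + c • E) * M).trace ≤ Fintype.card ι := by
    have h1 : (E * M).trace = M i i := by
      rw [hE, Matrix.vecMulVec_mul, Matrix.trace_vecMulVec]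
      simp
    rw [Matrix.add_mul, Matrix.smul_mul, Matrix.trace_add, Matrix.trace_smul, h1, smul_eq_mul, hc,
      sub_mul, inv_mul_cancel₀ hm.ne']
    rw [div_eq_inv_mul] at h
    linarith
  have hdet := hP.det_mul_le_one_of_trace_mul_le hM.posSemidef htr
  have h2 : N.det * (N⁻¹ + c • E).det = N i i / M i i := by
    rw [← Matrix.det_mul, Matrix.mul_add, Matrix.mul_nonsing_inv _ hu, Matrix.mul_smul, hE,
      Matrix.mul_vecMulVec, ← Matrix.smul_vecMulVec, Matrix.vecMulVec_eq Unit,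
      Matrix.det_one_add_replicateCol_mul_replicateRow]
    simp [hc]
    field_simp
    ring
  rw [Matrix.det_mul] at hdet
  have h3 := mul_le_mul_of_nonneg_left hdet hN.det_pos.le
  rw [← mul_assoc, h2, div_mul_eq_mul_div, div_le_iff₀ hm] at h3
  linarith

theorem Matrix.det_submatrix_succ_inv {n : ℕ} {M : Matrix (Fin (n + 1)) (Fin (n + 1)) ℝ}
    (hM : IsUnit M) : (M⁻¹.submatrix Fin.succ Fin.succ).det = M 0 0 / M.det := by
  have hu : IsUnit M.det := (Matrix.isUnit_iff_isUnit_det M).mp hM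
  have h := Matrix.adjugate_fin_succ_eq_det_submatrix M⁻¹ 0 0
  have h1 : M⁻¹.adjugate = M⁻¹.det • M := by
    have h2 := congrArg (fun X => X * M) (Matrix.adjugate_mul M⁻¹)
    simpa [Matrix.mul_assoc, Matrix.nonsing_inv_mul _ hu] using h2
  rw [h1] at h
  simp only [Matrix.smul_apply, Fin.succAbove_zero, Fin.val_zero, pow_zero, one_mul,
    smul_eq_mul, add_zero] at h
  rw [← h, Matrix.det_nonsing_inv, Ring.inverse_eq_inv, div_eq_inv_mul]

theorem Matrix.sum_smul_vecMulVec_eq {κ : Type*} [Fintype κ] [DecidableEq κ]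
    (c : κ → ℝ) (F : Matrix κ κ ℝ) :
    ∑ k, c k • vecMulVec (F k) (F k) = Fᵀ * diagonal c * F := by
  ext i j
  simp only [Matrix.sum_apply, Matrix.smul_apply, vecMulVec_apply, smul_eq_mul,
    Matrix.mul_apply (M := Fᵀ * diagonal c), Matrix.mul_diagonal, Matrix.transpose_apply]
  exact Finset.sum_congr rfl fun k _ => by ring

theorem Matrix.posDef_sum_smul_vecMulVec {κ : Type*} [Fintype κ] [DecidableEq κ]
    {c : κ → ℝ} (hc : ∀ k, 0 < c k) {F : Matrix κ κ ℝ} (hF : IsUnit F) :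
    (∑ k, c k • vecMulVec (F k) (F k)).PosDef := by
  refine ((Matrix.posSemidef_sum_smul_vecMulVec (fun k => (hc k).le) F).posDef_iff_isUnit).mpr ?_
  rw [Matrix.sum_smul_vecMulVec_eq]
  refine (IsUnit.mul ((Matrix.isUnit_transpose F).mpr hF) ?_).mul hF
  rw [Matrix.isUnit_diagonal, Pi.isUnit_iff]
  exact fun k => (hc k).ne'.isUnit

theorem Matrix.dotProduct_inv_sum_smul_vecMulVec_mulVec {κ : Type*} [Fintype κ] [DecidableEq κ]
    {c : κ → ℝ} (hc : ∀ k, 0 < c k) {F : Matrix κ κ ℝ} (hF : IsUnit F) (b : κ → ℝ) :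
    (b ᵥ* F) ⬝ᵥ (∑ k, c k • vecMulVec (F k) (F k))⁻¹ *ᵥ (b ᵥ* F) = ∑ k, b k ^ 2 / c k := by
  have hN := (Matrix.posDef_sum_smul_vecMulVec hc hF).isUnit
  have huF : IsUnit F.det := (Matrix.isUnit_iff_isUnit_det F).mp hF
  have huN := (Matrix.isUnit_iff_isUnit_det _).mp hN
  have hy : (∑ k, c k • vecMulVec (F k) (F k)) *ᵥ (F⁻¹ *ᵥ (fun k => b k / c k)) = b ᵥ* F := by
    rw [Matrix.sum_smul_vecMulVec_eq, Matrix.mulVec_mulVec, Matrix.mul_assoc,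
      Matrix.mul_nonsing_inv _ huF, Matrix.mul_one, ← Matrix.mulVec_mulVec,
      Matrix.mulVec_transpose]
    congr 1
    ext k
    rw [Matrix.mulVec_diagonal, mul_div_cancel₀ _ (hc k).ne']
  rw [← hy, Matrix.mulVec_mulVec _ _⁻¹, Matrix.nonsing_inv_mul _ huN, Matrix.one_mulVec, hy,
    ← Matrix.dotProduct_mulVec, Matrix.mulVec_mulVec, Matrix.mul_nonsing_inv _ huF,
    Matrix.one_mulVec]
  exact Finset.sum_congr rfl fun k _ => by ring

theorem Matrix.isUnit_of_eq_mul {n : ℕ} {M : Matrix (Fin (n + 1)) (Fin (n + 1)) ℝ}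
    (h0 : M 0 0 ≠ 0) {A : Matrix (Fin (n + 1)) (Fin n) ℝ}
    (hA : ∀ j i, A j i = if j = i.succ then 1 else 0)
    {H : Matrix (Fin (n + 1)) (Fin n) ℝ} (hAH : A = M * H) : IsUnit M := by
  rw [Matrix.isUnit_iff_isUnit_det, isUnit_iff_ne_zero]
  intro hdet
  obtain ⟨x, hx, hxM⟩ := Matrix.exists_vecMul_eq_zero_iff.mpr hdet
  have hxA : x ᵥ* A = 0 := by rw [hAH, ← Matrix.vecMul_vecMul, hxM, Matrix.zero_vecMul]
  have hs : ∀ i : Fin n, x i.succ = 0 := fun i => by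
    simpa [Matrix.vecMul, dotProduct, hA] using congrFun hxA i
  have hz : x 0 = 0 := by
    have := congrFun hxM 0
    simpa [Matrix.vecMul, dotProduct, Fin.sum_univ_succ, hs, h0] using this
  exact hx (funext fun j => Fin.cases hz hs j)

theorem fvec_succ_zero {n : ℕ} (x : Fin n → ℝ) : fvec (n + 1) x 0 = 1 := by
  simp [fvec]

theorem fvec_succ_succ {n : ℕ} (x : Fin n → ℝ) (i : Fin n) : fvec (n + 1) x i.succ = x i := by
  simp [fvec]

theorem fvec_dotProduct {n : ℕ} (x : Fin n → ℝ) (β : Fin (n + 1) → ℝ) :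
    fvec (n + 1) x ⬝ᵥ β = β 0 + ∑ i, x i * β i.succ := by
  simp [dotProduct, Fin.sum_univ_succ, fvec_succ_zero, fvec_succ_succ]

theorem infoMPo_zero_zero {n l : ℕ} (β : Fin (n + 1) → ℝ) (x : Fin l → Fin n → ℝ)
    (w : Fin l → ℝ) :
    infoMPo β x w 0 0 = ∑ j, w j * exp (fvec (n + 1) (x j) ⬝ᵥ β) := by
  simp only [infoMPo, Matrix.sum_apply, Matrix.smul_apply, vecMulVec_apply]
  exact Finset.sum_congr rfl fun j _ => by
    erw [fvec_succ_zero]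
    simp

/-- The support point `d - (z / β_j) e_j` for `j < n`, and `d` for `j = n`. -/
noncomputable def supportPt {n : ℕ} (β : Fin (n + 1) → ℝ) (d : Fin n → ℝ) (z : ℝ) :
    Fin (n + 1) → Fin n → ℝ :=
  Fin.snoc (fun i k => d k - if k = i then z / β i.succ else 0) d

/-- Coefficients of `g` in the basis of regression vectors at the support points. -/
noncomputable def supportCoord {n : ℕ} (β : Fin (n + 1) → ℝ) (d : Fin n → ℝ) (z : ℝ)
    (g : Fin (n + 1) → ℝ) : Fin (n + 1) → ℝ :=
  Fin.snoc (fun i => β i.succ * (d i * g 0 - g i.succ) / z)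
    (g 0 - ∑ i, β i.succ * (d i * g 0 - g i.succ) / z)

/-- The matrix whose rows are the regression vectors at the support points. -/
noncomputable def supportMatrix {n : ℕ} (β : Fin (n + 1) → ℝ) (d : Fin n → ℝ) (z : ℝ) :
    Matrix (Fin (n + 1)) (Fin (n + 1)) ℝ :=
  Matrix.of fun k => fvec (n + 1) (supportPt (n := n) β d z k)

section Support

variable {n : ℕ} {β : Fin (n + 1) → ℝ} {d : Fin n → ℝ} {z : ℝ}

theorem supportPt_castSucc (i : Fin n) :
    supportPt β d z i.castSucc = fun k => d k - if k = i then z / β i.succ else 0 := by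
  simp [supportPt]

theorem supportPt_last : supportPt β d z (Fin.last n) = d := by
  simp [supportPt]

theorem supportCoord_vecMul (hβ : ∀ i : Fin n, β i.succ ≠ 0) (hz : z ≠ 0)
    (g : Fin (n + 1) → ℝ) :
    supportCoord β d z g ᵥ* supportMatrix β d z = g := by
  ext j
  refine Fin.cases ?_ (fun k => ?_) j
  · simp [Matrix.vecMul, dotProduct, supportMatrix, fvec_succ_zero, Fin.sum_univ_castSucc,
      supportCoord]
  · have h1 : ∀ i : Fin n, β i.succ * (d i * g 0 - g i.succ) / z *
        (d k - if k = i then z / β i.succ else 0) =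
        d k * (β i.succ * (d i * g 0 - g i.succ) / z) -
          if k = i then d i * g 0 - g i.succ else 0 := fun i => by
      have := hβ i
      split_ifs
      · field_simp
      · ring
    simp only [Matrix.vecMul, dotProduct, supportMatrix, Matrix.of_apply, fvec_succ_succ,
      Fin.sum_univ_castSucc, supportCoord, supportPt_castSucc, supportPt_last, Fin.snoc_castSucc,
        Fin.snoc_last, h1, Finset.sum_sub_distrib, ← Finset.mul_sum,
      Finset.sum_ite_eq, Finset.mem_univ, if_true]
    ring

theorem isUnit_support (hβ : ∀ i : Fin n, β i.succ ≠ 0) (hz : z ≠ 0) :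
    IsUnit (supportMatrix β d z) := by
  rw [← Matrix.isUnit_transpose, ← Matrix.mulVec_surjective_iff_isUnit]
  exact fun g => ⟨supportCoord β d z g, by
    rw [Matrix.mulVec_transpose, supportCoord_vecMul hβ hz]⟩

theorem fvec_supportPt_castSucc_dotProduct (hβ : ∀ i : Fin n, β i.succ ≠ 0) (i : Fin n) :
    fvec (n + 1) (supportPt (n := n) β d z i.castSucc) ⬝ᵥ β = fvec (n + 1) d ⬝ᵥ β - z := by
  rw [fvec_dotProduct, fvec_dotProduct]
  simp [supportPt_castSucc, sub_mul, hβ]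
  ring

theorem fvec_supportPt_last :
    fvec (n + 1) (supportPt (n := n) β d z (Fin.last n)) = fvec (n + 1) d := by
  rw [supportPt_last]

theorem infoMPo_support_posDef (hβ : ∀ i : Fin n, β i.succ ≠ 0) (hz : z ≠ 0)
    {w : Fin (n + 1) → ℝ} (hw : ∀ k, 0 < w k) :
    (infoMPo β (supportPt (n := n) β d z) w).PosDef :=
  Matrix.posDef_sum_smul_vecMulVec
    (c := fun k => w k * exp (fvec (n + 1) (supportPt (n := n) β d z k) ⬝ᵥ β))
    (fun k => mul_pos (hw k) (exp_pos _)) (isUnit_support hβ hz)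

/-- The sensitivity of the optimal design is bounded by `n` on the whole cone
`β i.succ * (d i - x i) ≥ 0`. -/
theorem support_sensitivity_le (hn : 0 < n) (hβ : ∀ i : Fin n, β i.succ ≠ 0) (hz : 0 < z)
    {w : ℝ} (hw : 0 < w) (hw1 : w < 1) (hzw : z * (1 - w) = 2)
    (hquad : (1 - w) * (1 - n * w) = n * exp z * w ^ 2)
    {ws : Fin (n + 1) → ℝ} (hws : ∀ i : Fin n, ws i.castSucc = (1 - w) / n)
    (hwl : ws (Fin.last n) = w) (x : Fin n → ℝ) (hx : ∀ i, 0 ≤ β i.succ * (d i - x i)) :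
    exp (fvec (n + 1) x ⬝ᵥ β) * (fvec (n + 1) x ⬝ᵥ (infoMPo β (supportPt (n := n) β d z) ws)⁻¹ *ᵥ
      fvec (n + 1) x - (infoMPo β (supportPt (n := n) β d z) ws 0 0)⁻¹) ≤ n := by
  have hn' : (0 : ℝ) < n := Nat.cast_pos.mpr hn
  have h1w : 0 < 1 - w := by linarith
  have hwpos : ∀ k, 0 < ws k := fun k => by
    refine Fin.lastCases (by rwa [hwl]) (fun i => ?_) k
    rw [hws]
    positivity
  set τ : ℝ := ∑ i, β i.succ * (d i - x i) with hτ
  have hτ0 : 0 ≤ τ := Finset.sum_nonneg fun i _ => hx i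
  have hsq : ∑ i, (β i.succ * (d i - x i)) ^ 2 ≤ τ ^ 2 :=
    Finset.sum_sq_le_sq_sum_of_nonneg fun i _ => hx i
  have hlin : fvec (n + 1) x ⬝ᵥ β = fvec (n + 1) d ⬝ᵥ β - τ := by
    rw [fvec_dotProduct, fvec_dotProduct, hτ, add_sub_assoc, ← Finset.sum_sub_distrib]
    congr 1
    exact Finset.sum_congr rfl fun i _ => by ring
  have hQ := Matrix.dotProduct_inv_sum_smul_vecMulVec_mulVec
    (c := fun k => ws k * exp (fvec (n + 1) (supportPt (n := n) β d z k) ⬝ᵥ β))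
    (fun k => mul_pos (hwpos k) (exp_pos _)) (isUnit_support (d := d) hβ hz.ne')
    (supportCoord β d z (fvec (n + 1) x))
  rw [supportCoord_vecMul hβ hz.ne'] at hQ
  have h00 := infoMPo_zero_zero β (supportPt (n := n) β d z) ws
  change fvec (n + 1) x ⬝ᵥ (infoMPo β (supportPt (n := n) β d z) ws)⁻¹ *ᵥ fvec (n + 1) x = _ at hQ
  rw [hQ, h00, hlin]
  simp only [Fin.sum_univ_castSucc, hws, hwl, fvec_supportPt_castSucc_dotProduct hβ,
    fvec_supportPt_last, supportCoord, Fin.snoc_castSucc, Fin.snoc_last, fvec_succ_zero,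
    fvec_succ_succ, mul_one, exp_sub, ← Finset.sum_div, Finset.sum_const, Finset.card_univ,
    Fintype.card_fin, nsmul_eq_mul, div_pow, ← hτ]
  have hmain := quadratic_le_mul_exp hn' hw hw1 hz (div_nonneg hτ0 hz.le) hzw hquad
  rw [mul_div_cancel₀ _ hz.ne'] at hmain
  have hC := exp_pos (fvec (n + 1) d ⬝ᵥ β)
  have hT := exp_pos τ
  have hE := exp_pos z
  generalize exp (fvec (n + 1) d ⬝ᵥ β) = C at *
  generalize exp τ = T at *
  generalize exp z = E at *
  generalize ∑ i, (β i.succ * (d i - x i)) ^ 2 = S at *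
  have hstep : C / T * (S / z ^ 2 / ((1 - w) / n * (C / E)) + (1 - τ / z) ^ 2 / (w * C) -
      (n * ((1 - w) / n * (C / E)) + w * C)⁻¹) =
      (n * E / (1 - w) * (S / z ^ 2) + (1 - τ / z) ^ 2 / w - E / (1 - w + w * E)) / T := by
    have hD : 0 < 1 - w + w * E := by positivity
    have h1 : n * ((1 - w) / n * (C / E)) + w * C = C * (1 - w + w * E) / E := by
      field_simp
    rw [h1]
    field_simp
  rw [hstep, div_le_iff₀ hT]
  refine le_trans ?_ hmain
  rw [div_pow τ]
  gcongr

end Support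

theorem weight_quadratic_eq {n E w : ℝ} (hn : 1 ≤ n) (hE : 0 < E)
    (hw : w = 2 / (n + 1 + √((n - 1) ^ 2 + 4 * n * E))) :
    0 < w ∧ w < 1 ∧ (1 - w) * (1 - n * w) = n * E * w ^ 2 := by
  have harg : 0 < (n - 1) ^ 2 + 4 * n * E := by positivity
  have hs := Real.sqrt_pos.mpr harg
  have hsq := Real.sq_sqrt harg.le
  generalize √((n - 1) ^ 2 + 4 * n * E) = s at *
  have hden : 0 < n + 1 + s := by linarith
  refine ⟨by rw [hw]; positivity, by rw [hw, div_lt_one hden]; linarith, ?_⟩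
  rw [hw]
  field_simp
  linear_combination hsq

theorem transpose_mul_mul_eq_submatrix {n : ℕ} {A : Matrix (Fin (n + 1)) (Fin n) ℝ}
    (hA : ∀ j i, A j i = if j = i.succ then 1 else 0)
    (G : Matrix (Fin (n + 1)) (Fin (n + 1)) ℝ) :
    Aᵀ * G * A = G.submatrix Fin.succ Fin.succ := by
  ext i j
  simp [Matrix.mul_apply, hA]

theorem det_transpose_mul_inv_support_mul_le {n : ℕ} {β : Fin (n + 1) → ℝ} {d : Fin n → ℝ}
    {z : ℝ} (hn : 0 < n) (hβ : ∀ i : Fin n, β i.succ ≠ 0) (hz : 0 < z)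
    {w : ℝ} (hw : 0 < w) (hw1 : w < 1) (hzw : z * (1 - w) = 2)
    (hquad : (1 - w) * (1 - n * w) = n * exp z * w ^ 2)
    {ws : Fin (n + 1) → ℝ} (hws : ∀ i : Fin n, ws i.castSucc = (1 - w) / n)
    (hwl : ws (Fin.last n) = w)
    {A : Matrix (Fin (n + 1)) (Fin n) ℝ} (hA : ∀ j i, A j i = if j = i.succ then 1 else 0) :
    IsUnit (infoMPo β (supportPt (n := n) β d z) ws) ∧
    ∀ (l : ℕ) (y : Fin l → Fin n → ℝ) (q : Fin l → ℝ),
      (∀ j, 0 ≤ q j) → (∑ j, q j) = 1 → (∀ j i, 0 ≤ β i.succ * (d i - y j i)) →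
      ∀ G : Matrix (Fin (n + 1)) (Fin (n + 1)) ℝ,
        infoMPo β y q * G * infoMPo β y q = infoMPo β y q →
        (∃ H : Matrix (Fin (n + 1)) (Fin n) ℝ, A = infoMPo β y q * H) →
        (Aᵀ * (infoMPo β (supportPt (n := n) β d z) ws)⁻¹ * A).det ≤ (Aᵀ * G * A).det := by
  have hwpos : ∀ k, 0 < ws k := fun k => by
    refine Fin.lastCases (by rwa [hwl]) (fun i => ?_) k
    rw [hws]
    exact div_pos (by linarith) (Nat.cast_pos.mpr hn)
  have hN : (infoMPo β (supportPt (n := n) β d z) ws).PosDef :=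
    infoMPo_support_posDef hβ hz.ne' hwpos
  refine ⟨hN.isUnit, fun l y q hq hq1 hy G hG ⟨H, hH⟩ => ?_⟩
  set N := infoMPo β (supportPt (n := n) β d z) ws with hNdef
  set M := infoMPo β y q with hMdef
  have hM00 : M 0 0 = ∑ j, q j * exp (fvec (n + 1) (y j) ⬝ᵥ β) := infoMPo_zero_zero β y q
  have hM0 : 0 < M 0 0 := by
    have hnn : ∀ j ∈ Finset.univ, 0 ≤ q j * exp (fvec (n + 1) (y j) ⬝ᵥ β) :=
      fun j _ => mul_nonneg (hq j) (exp_pos _).le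
    rw [hM00]
    refine (Finset.sum_nonneg hnn).lt_of_ne' fun h0 => ?_
    rw [Finset.sum_eq_zero_iff_of_nonneg hnn] at h0
    have : ∑ j, q j = 0 := Finset.sum_eq_zero fun j hj =>
      (mul_eq_zero.mp (h0 j hj)).resolve_right (exp_pos _).ne'
    linarith
  have hMu : IsUnit M := Matrix.isUnit_of_eq_mul hM0.ne' hA hH
  have hMps : M.PosSemidef := Matrix.posSemidef_sum_smul_vecMulVec
    (fun j => mul_nonneg (hq j) (exp_pos _).le) _
  have hM : M.PosDef := hMps.posDef_iff_isUnit.mpr hMu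
  have hGinv : G = M⁻¹ := by
    refine (Matrix.inv_eq_right_inv (hMu.mul_right_cancel ?_)).symm
    rw [hG, Matrix.one_mul]
  rw [hGinv, transpose_mul_mul_eq_submatrix hA, transpose_mul_mul_eq_submatrix hA,
    Matrix.det_submatrix_succ_inv hN.isUnit, Matrix.det_submatrix_succ_inv hMu,
    div_le_div_iff₀ hN.det_pos hM.det_pos, mul_comm, mul_comm (M 0 0)]
  refine hN.det_mul_diag_le hM 0 ?_
  have htr : (N⁻¹ * M).trace = ∑ j, q j * exp (fvec (n + 1) (y j) ⬝ᵥ β) *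
      (fvec (n + 1) (y j) ⬝ᵥ N⁻¹ *ᵥ fvec (n + 1) (y j)) :=
    Matrix.trace_mul_sum_smul_vecMulVec N⁻¹ _ _
  rw [htr, hM00, Finset.sum_div, ← Finset.sum_sub_distrib]
  calc _ = ∑ j, q j * (exp (fvec (n + 1) (y j) ⬝ᵥ β) *
        (fvec (n + 1) (y j) ⬝ᵥ N⁻¹ *ᵥ fvec (n + 1) (y j) - (N 0 0)⁻¹)) :=
        Finset.sum_congr rfl fun j _ => by ring
    _ ≤ ∑ j, q j * n := Finset.sum_le_sum fun j _ => mul_le_mul_of_nonneg_left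
        (support_sensitivity_le hn hβ hz hw hw1 hzw hquad hws hwl (y j) (hy j)) (hq j)
    _ = (Fintype.card (Fin (n + 1)) : ℝ) - 1 := by
        rw [← Finset.sum_mul, hq1]
        simp

/-- The `D_s`-optimal design for `β₁,…,β_{p−1}` in the Poisson model with multiple
regression on the rectangular design region `X`: its Poisson information matrix is
invertible, and for every competing design `ξ` on `X` for which `Aᵀβ` is identifiable,
with generalized inverse `G` of `M_Po(ξ;β)`, one has
`det(Aᵀ M_Po(ξ*;β)⁻¹ A) ≤ det(Aᵀ G A)`, where `Aᵀ = (0_{p−1}, I_{p−1})`. -/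
theorem Ds_optimal_design_poisson
    (p : ℕ) (hp : 2 ≤ p)
    (u v : Fin (p - 1) → ℝ) (huv : ∀ i, u i < v i)
    (β : Fin p → ℝ)
    (ι : Fin (p - 1) → Fin p) (hι : ∀ i, (ι i : ℕ) = (i : ℕ) + 1)
    (hβ : ∀ i, β (ι i) ≠ 0)
    (d : Fin (p - 1) → ℝ)
    (hd : ∀ i, (0 < β (ι i) → d i = v i) ∧ (β (ι i) < 0 → d i = u i))
    (wpf w1f : ℝ → ℝ)
    (hwpf : ∀ z, wpf z = 2 / ((p : ℝ) + Real.sqrt (((p : ℝ) - 2) ^ 2 +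
      4 * ((p : ℝ) - 1) * Real.exp z)))
    (hw1f : ∀ z, w1f z = (1 - wpf z) / ((p : ℝ) - 1))
    (zs : ℝ) (hzs : 0 < zs) (hzeq : zs * (1 - wpf zs) = 2)
    (hzuniq : ∀ z : ℝ, 0 < z → z * (1 - wpf z) = 2 → z = zs)
    (hzmin : ∀ i, zs ≤ |β (ι i)| * (v i - u i))
    (xs : Fin p → Fin (p - 1) → ℝ)
    (hxs : ∀ j : Fin p, xs j = if h : (j : ℕ) < p - 1
      then (fun k => d k - if k = (⟨(j : ℕ), h⟩ : Fin (p - 1))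
        then zs / β (ι ⟨(j : ℕ), h⟩) else 0)
      else d)
    (ws : Fin p → ℝ)
    (hws : ∀ j : Fin p, ws j = if (j : ℕ) < p - 1 then w1f zs else wpf zs)
    (A : Matrix (Fin p) (Fin (p - 1)) ℝ)
    (hA : ∀ j i, A j i = if (j : ℕ) = (i : ℕ) + 1 then 1 else 0) :
    IsUnit (infoMPo β xs ws) ∧
    ∀ (l : ℕ) (y : Fin l → Fin (p - 1) → ℝ) (q : Fin l → ℝ),
      (∀ j, 0 ≤ q j) → (∑ j, q j) = 1 →
      (∀ j i, u i ≤ y j i ∧ y j i ≤ v i) →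
      ∀ G : Matrix (Fin p) (Fin p) ℝ,
        infoMPo β y q * G * infoMPo β y q = infoMPo β y q →
        (∃ H : Matrix (Fin p) (Fin (p - 1)) ℝ, A = infoMPo β y q * H) →
        (Aᵀ * (infoMPo β xs ws)⁻¹ * A).det ≤ (Aᵀ * G * A).det := by
  obtain ⟨n, rfl⟩ : ∃ n, p = n + 1 := ⟨p - 1, by omega⟩
  have hn : 0 < n := by omega
  have hιs : ∀ i : Fin n, ι i = i.succ := fun i => Fin.ext (by simpa using hι i)
  have hβ' : ∀ i : Fin n, β i.succ ≠ 0 := fun i => hιs i ▸ hβ i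
  have hw : wpf zs = 2 / ((n : ℝ) + 1 + √(((n : ℝ) - 1) ^ 2 + 4 * n * exp zs)) := by
    rw [hwpf]
    push_cast
    ring_nf
  obtain ⟨hw0, hw1, hquad⟩ :=
    weight_quadratic_eq (Nat.one_le_cast.mpr hn) (exp_pos zs) hw
  have hxs' : xs = supportPt (n := n) β d zs := by
    funext j
    rw [hxs]
    refine Fin.lastCases ?_ (fun i => ?_) j
    · rw [supportPt_last, dif_neg (by simp)]
    · have hlt : ((i.castSucc : Fin (n + 1)) : ℕ) < n + 1 - 1 := by simp
      rw [supportPt_castSucc, dif_pos hlt]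
      funext k
      rw [← hιs i]
      rfl
  have hws1 : ∀ i : Fin n, ws i.castSucc = (1 - wpf zs) / n := fun i => by
    rw [hws, if_pos (by simp), hw1f]
    push_cast
    ring_nf
  have hws2 : ws (Fin.last n) = wpf zs := by
    rw [hws, if_neg (by simp)]
  have hA' : ∀ (j : Fin (n + 1)) (i : Fin n), A j i = if j = i.succ then 1 else 0 := fun j i => by
    rw [hA]
    simp [Fin.ext_iff]
  subst hxs'
  have main := det_transpose_mul_inv_support_mul_le (d := d) hn hβ' hzs hw0 hw1 hzeq hquad hws1
    hws2 hA'
  refine ⟨main.1, fun l y q hq hq1 hy => main.2 l y q hq hq1 fun j i => ?_⟩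
  have hyi := hy j i
  have hdi := hd i
  rw [hιs] at hdi
  rcases lt_or_gt_of_ne (hβ' i) with h | h
  · have := hdi.2 h
    exact mul_nonneg_of_nonpos_of_nonpos h.le (by linarith)
  · have := hdi.1 h
    exact mul_nonneg h.le (by linarith)
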